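/- For every d ≥ 0 and every x ∈ {0,1}^(4^d), the average choice complexity for Player A equals the effective resistance of the associated graph: C_A(x) = R_{s,t}(G_d(x)); in particular both sides are ∞ exactly when x is a 0-instance. -/

import Mathlib

open scoped ENNReal
open scoped Classical

namespace NandTree

/-- The bit-`b` half of an input of length `2^(m+1)`: `b = false` gives the first half,
`b = true` the second half (lexicographic indexing, first bit most significant). -/
def halfInput (m : ℕ) (b : Bool) (x : Fin (2^(m+1)) → Bool) : Fin (2^m) → Bool :=
  fun i => x ⟨(cond b 1 0) * 2^m + i.val, by
    have h := i.isLt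
    have h2 : (2:ℕ)^(m+1) = 2^m * 2 := pow_succ 2 m
    cases b <;> simp only [cond_true, cond_false] <;> omega⟩

/-- The value `NAND_ℓ(x)` of a depth-`ℓ` NAND-tree instance: internal nodes at even
distance from the leaves are OR gates, at odd distance AND gates. -/
def nand : (ℓ : ℕ) → (Fin (2^ℓ) → Bool) → Bool
  | 0, x => x ⟨0, by norm_num⟩
  | (ℓ+1), x =>
    if (ℓ+1) % 2 = 0 then
      nand ℓ (halfInput ℓ false x) || nand ℓ (halfInput ℓ true x)
    else
      nand ℓ (halfInput ℓ false x) && nand ℓ (halfInput ℓ true x)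

/-- Index of a leaf given by a root-to-leaf bit string (lexicographic, first bit most
significant). -/
def leafIdx (s : List Bool) : ℕ := s.foldl (fun n b => 2 * n + cond b 1 0) 0

/-- The value of the leaf reached by bit string `s` in instance `x`. -/
def leafVal (m : ℕ) (x : Fin (2^m) → Bool) (s : List Bool) : Bool :=
  if h : leafIdx s < 2^m then x ⟨leafIdx s, h⟩ else false

/-- The root-to-leaf path determined by strategies `σA`, `σB` (each assigning a choice of
child to every node, nodes being given by the list of choices from the root): at a node
at distance `m+1` from the leaves, Player A chooses a child if `m+1` is even, else
Player B chooses. -/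
def gamePath (σA σB : List Bool → Bool) : (m : ℕ) → List Bool → List Bool
  | 0, p => p
  | (m+1), p => gamePath σA σB m (p ++ [if (m+1) % 2 = 0 then σA p else σB p])

/-- `winning Z m x σ`: strategy `σ` is a winning strategy for player `Z` (`true` = A,
`false` = B) in the two-player game on the depth-`m` instance `x`: against every
opponent strategy, the reached leaf has value `Z` (A wins on `1 = true`, B on
`0 = false`). -/
def winning (Z : Bool) (m : ℕ) (x : Fin (2^m) → Bool) (σ : List Bool → Bool) : Prop :=
  ∀ τ : List Bool → Bool,
    leafVal m x (gamePath (if Z then σ else τ) (if Z then τ else σ) m []) = Z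

mutual

/-- The criticality `c(v)` of the root of a depth-`m` subtree with input `y`. -/
noncomputable def crit : (m : ℕ) → (Fin (2^m) → Bool) → ℝ≥0∞
  | 0, _ => 1
  | 1, y => if y ⟨0, by norm_num⟩ = y ⟨1, by norm_num⟩ then 1 else 2
  | (m+2), y =>
    if nand (m+2) y ≠ decide ((m+2) % 2 = 0) then 1
    else if nand (m+1) (halfInput (m+1) false y) ≠ nand (m+1) (halfInput (m+1) true y) then 2
    else
      (max (CZ (decide ((m+2) % 2 = 0)) m (halfInput m false (halfInput (m+1) false y)) +
            CZ (decide ((m+2) % 2 = 0)) m (halfInput m true (halfInput (m+1) false y)))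
           (CZ (decide ((m+2) % 2 = 0)) m (halfInput m false (halfInput (m+1) true y)) +
            CZ (decide ((m+2) % 2 = 0)) m (halfInput m true (halfInput (m+1) true y)))) /
      (((CZ (decide ((m+2) % 2 = 0)) m (halfInput m false (halfInput (m+1) false y)) +
         CZ (decide ((m+2) % 2 = 0)) m (halfInput m true (halfInput (m+1) false y))) +
        ((CZ (decide ((m+2) % 2 = 0)) m (halfInput m false (halfInput (m+1) true y)) +
          CZ (decide ((m+2) % 2 = 0)) m (halfInput m true (halfInput (m+1) true y))))) / 2)
termination_by m _ => (m, 0)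

/-- The expected product, over the random choices of `Z`'s opponent, of the criticalities
of the nodes at which `Z` moves along the path played according to strategy `σ`. -/
noncomputable def pathProd (Z : Bool) :
    (σ : List Bool → Bool) → (m : ℕ) → (Fin (2^m) → Bool) → ℝ≥0∞
  | _, 0, _ => 1
  | σ, (m+1), y =>
    if decide ((m+1) % 2 = 0) = Z then
      crit (m+1) y * pathProd Z (fun q => σ (σ [] :: q)) m (halfInput m (σ []) y)
    else
      (pathProd Z (fun q => σ (false :: q)) m (halfInput m false y) +
       pathProd Z (fun q => σ (true :: q)) m (halfInput m true y)) / 2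
termination_by _ m _ => (m, 1)

/-- The average choice complexity `C_Z` of a depth-`m` instance `y` for player `Z`
(`true` = A, `false` = B): the infimum, over `Z`-winning strategies, of the expected
product of criticalities over the nodes where `Z` moves (and `∞` if `Z` has no winning
strategy, the infimum over the empty set being `⊤`). -/
noncomputable def CZ (Z : Bool) (m : ℕ) (y : Fin (2^m) → Bool) : ℝ≥0∞ :=
  ⨅ σ ∈ {σ : List Bool → Bool | winning Z m y σ}, pathProd Z σ m y
termination_by (m, 2)

end

/-- Edges of the graph `G_d`: `G_0` has a single edge; each edge `e` of `G_d` is replaced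
by four edges `(e, b, c)` in `G_{d+1}`, where `b` selects one of the two length-2 paths
and `c` selects the side (`false`: the `u`-side edge, `true`: the `v`-side edge). -/
def Edg : ℕ → Type
  | 0 => Unit
  | (d+1) => Edg d × Bool × Bool

/-- Vertices of `G_d`: `G_0` has vertices `s = false`, `t = true`; `G_{d+1}` has the
vertices of `G_d` plus one new middle vertex `(e, b)` for each edge `e` of `G_d` and
each of the two length-2 paths `b` replacing it. -/
def Vtx : ℕ → Type
  | 0 => Bool
  | (d+1) => Vtx d ⊕ (Edg d × Bool)

instance edgFintype : (d : ℕ) → Fintype (Edg d)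
  | 0 => inferInstanceAs (Fintype Unit)
  | (d+1) => letI := edgFintype d; inferInstanceAs (Fintype (Edg d × Bool × Bool))

instance edgDecEq : (d : ℕ) → DecidableEq (Edg d)
  | 0 => inferInstanceAs (DecidableEq Unit)
  | (d+1) => letI := edgDecEq d; inferInstanceAs (DecidableEq (Edg d × Bool × Bool))

instance vtxDecEq : (d : ℕ) → DecidableEq (Vtx d)
  | 0 => inferInstanceAs (DecidableEq Bool)
  | (d+1) => letI := edgDecEq d; letI := vtxDecEq d
             inferInstanceAs (DecidableEq (Vtx d ⊕ (Edg d × Bool)))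

/-- The two endpoints of an edge of `G_d`: `ep d e false` is the `u`-end and
`ep d e true` is the `v`-end. -/
def ep : (d : ℕ) → Edg d → Bool → Vtx d
  | 0, _, k => k
  | (d+1), (e, b, c), k =>
    match c, k with
    | false, false => Sum.inl (ep d e false)
    | false, true  => Sum.inr (e, b)
    | true,  false => Sum.inr (e, b)
    | true,  true  => Sum.inl (ep d e true)

/-- The vertex `s` of `G_d`. -/
def sVtx : (d : ℕ) → Vtx d
  | 0 => false
  | (d+1) => Sum.inl (sVtx d)

/-- The vertex `t` of `G_d`. -/
def tVtx : (d : ℕ) → Vtx d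
  | 0 => true
  | (d+1) => Sum.inl (tVtx d)

/-- The label of an edge of `G_d`, a bit string of length `2d`: the edge of `G_0` is
labeled by the empty string, and the four edges replacing an edge labeled `τ` are
labeled `τ00`, `τ01` (the two edges of the first path, `u`- and `v`-side) and
`τ10`, `τ11` (the two edges of the second path). -/
def elabel : (d : ℕ) → Edg d → List Bool
  | 0, _ => []
  | (d+1), (e, b, c) => elabel d e ++ [b, c]

/-- The input bit of `x` associated with edge `e` of `G_d` (bits of `x` indexed by the
edge labels in lexicographic order). -/
def edgeBit (d : ℕ) (x : Fin (2^(2*d)) → Bool) (e : Edg d) : Bool :=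
  leafVal (2*d) x (elabel d e)

/-- Two vertices are adjacent via a kept edge. -/
def adjE {V E : Type} (epf : E → Bool → V) (keep : E → Prop) (u v : V) : Prop :=
  ∃ e, keep e ∧ ((epf e false = u ∧ epf e true = v) ∨ (epf e false = v ∧ epf e true = u))

/-- `a` and `b` are connected in the (multi)graph with endpoint map `epf`, restricted to
the edges satisfying `keep`. -/
def ConnectedIn {V E : Type} (epf : E → Bool → V) (keep : E → Prop) (a b : V) : Prop :=
  Relation.ReflTransGen (adjE epf keep) a b

/-- The net flow of `θ` out of vertex `v` (each edge oriented from its `false` endpoint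
to its `true` endpoint; a function on oriented edges with `θ(rev e) = -θ(e)` is the same
data as a function on these chosen orientations). -/
noncomputable def netFlow {V E : Type} [Fintype E] (epf : E → Bool → V) (θ : E → ℝ)
    (v : V) : ℝ :=
  ∑ e, θ e * ((if epf e false = v then (1:ℝ) else 0) - (if epf e true = v then 1 else 0))

/-- `θ` is a unit `s`-`t` flow supported on the kept edges: it vanishes on discarded
edges, has net outflow `1` at `s`, net inflow `1` at `t`, and zero net flow elsewhere. -/
def IsUnitFlow {V E : Type} [Fintype E] (epf : E → Bool → V) (keep : E → Prop)
    (s t : V) (θ : E → ℝ) : Prop :=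
  (∀ e, ¬ keep e → θ e = 0) ∧
  (∀ v, netFlow epf θ v = (if v = s then (1:ℝ) else 0) - (if v = t then 1 else 0))

/-- The effective resistance between `s` and `t` in the (multi)graph given by the edges
satisfying `keep`: the least energy of a unit `s`-`t` flow if `s` and `t` are connected,
and `∞` otherwise. -/
noncomputable def effRes {V E : Type} [Fintype E] (epf : E → Bool → V) (keep : E → Prop)
    (s t : V) : ℝ≥0∞ :=
  if ConnectedIn epf keep s t then
    ⨅ θ ∈ {θ : E → ℝ | IsUnitFlow epf keep s t θ}, ENNReal.ofReal (∑ e, (θ e)^2)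
  else ⊤

/-! ### Game-tree side -/

/-- Parallel combination of two resistances. -/
noncomputable def par (a b : ℝ≥0∞) : ℝ≥0∞ := (a⁻¹ + b⁻¹)⁻¹

lemma par_top_left (a : ℝ≥0∞) : par ⊤ a = a := by simp [par]

lemma par_top_right (a : ℝ≥0∞) : par a ⊤ = a := by simp [par]

lemma leafIdx_foldl (s : List Bool) (n : ℕ) :
    s.foldl (fun n b => 2 * n + cond b 1 0) n = n * 2 ^ s.length + leafIdx s := by
  induction s generalizing n with
  | nil => simp [leafIdx]
  | cons b s ih =>
    simp only [leafIdx, List.foldl_cons, List.length_cons]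
    rw [ih, ih (2 * 0 + cond b 1 0)]
    ring

lemma leafIdx_cons (b : Bool) (s : List Bool) :
    leafIdx (b :: s) = cond b 1 0 * 2 ^ s.length + leafIdx s := by
  have := leafIdx_foldl s (cond b 1 0)
  simpa [leafIdx] using this

lemma leafVal_cons (m : ℕ) (x : Fin (2^(m+1)) → Bool) (b : Bool) (s : List Bool)
    (hs : s.length = m) : leafVal (m+1) x (b :: s) = leafVal m (halfInput m b x) s := by
  subst hs
  have h1 : leafIdx (b :: s) < 2 ^ (s.length + 1) ↔ leafIdx s < 2 ^ s.length := by
    rw [leafIdx_cons]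
    have h2 : (2:ℕ)^(s.length+1) = 2^s.length * 2 := pow_succ 2 _
    have : leafIdx s < 2 ^ s.length := by
      clear h2
      induction s with
      | nil => simp [leafIdx]
      | cons c s ih =>
        have ih := ih (fun _ => false)
        rw [leafIdx_cons, List.length_cons, pow_succ]
        cases c <;> simp <;> omega
    cases b <;> simp <;> omega
  unfold leafVal
  by_cases h : leafIdx s < 2 ^ s.length
  · rw [dif_pos (h1.2 h), dif_pos h]
    simp only [halfInput, leafIdx_cons]
  · rw [dif_neg (fun h' => h (h1.1 h')), dif_neg h]

lemma gamePath_cons (σA σB : List Bool → Bool) (m : ℕ) (b : Bool) (p : List Bool) :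
    gamePath σA σB m (b :: p)
      = b :: gamePath (fun q => σA (b :: q)) (fun q => σB (b :: q)) m p := by
  induction m generalizing p with
  | zero => rfl
  | succ m ih => simp only [gamePath, List.cons_append, ih]

lemma gamePath_length (σA σB : List Bool → Bool) (m : ℕ) (p : List Bool) :
    (gamePath σA σB m p).length = m + p.length := by
  induction m generalizing p with
  | zero => simp [gamePath]
  | succ m ih => simp only [gamePath, ih]; simp; omega

/-- Prepend a first move to a strategy. -/
def consStrat (b : Bool) (τ : List Bool → Bool) : List Bool → Bool
  | [] => b
  | _ :: q => τ q

lemma leafVal_step (m : ℕ) (x : Fin (2^(m+1)) → Bool) (σ τ : List Bool → Bool) :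
    leafVal (m+1) x (gamePath σ τ (m+1) []) =
      leafVal m (halfInput m (if (m+1) % 2 = 0 then σ [] else τ []) x)
        (gamePath (fun q => σ ((if (m+1) % 2 = 0 then σ [] else τ []) :: q))
          (fun q => τ ((if (m+1) % 2 = 0 then σ [] else τ []) :: q)) m []) := by
  simp only [gamePath, List.nil_append]
  rw [gamePath_cons, leafVal_cons]
  rw [gamePath_length]; simp

lemma winning_even (m : ℕ) (hm : (m+1) % 2 = 0) (x : Fin (2^(m+1)) → Bool)
    (σ : List Bool → Bool) :
    winning true (m+1) x σ ↔ winning true m (halfInput m (σ []) x) (fun q => σ (σ [] :: q)) := by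
  simp only [winning, if_true, leafVal_step, hm]
  constructor
  · intro h τ
    exact h (consStrat false τ)
  · intro h τ
    exact h _

lemma winning_odd (m : ℕ) (hm : ¬ (m+1) % 2 = 0) (x : Fin (2^(m+1)) → Bool)
    (σ : List Bool → Bool) :
    winning true (m+1) x σ ↔
      ∀ b, winning true m (halfInput m b x) (fun q => σ (b :: q)) := by
  simp only [winning, if_true, leafVal_step, hm, if_false]
  constructor
  · intro h b τ
    exact h (consStrat b τ)
  · intro h τ
    exact h _ _

/-- The grandchild inputs. -/
def gch (m : ℕ) (b c : Bool) (y : Fin (2^(m+2)) → Bool) : Fin (2^m) → Bool :=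
  halfInput m c (halfInput (m+1) b y)

/-- Invariant carried along the recursion at even depths. -/
structure Inv (m : ℕ) (y : Fin (2^m) → Bool) : Prop where
  lose : nand m y = false → CZ true m y = ⊤
  noWin : nand m y = false → ∀ σ, ¬ winning true m y σ
  win : nand m y = true → CZ true m y ≠ ⊤
  att : nand m y = true → ∃ σ, winning true m y σ ∧ pathProd true σ m y = CZ true m y
  pos : CZ true m y ≠ 0

lemma CZ_le {m : ℕ} {y : Fin (2^m) → Bool} {σ : List Bool → Bool} (h : winning true m y σ) :
    CZ true m y ≤ pathProd true σ m y := by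
  rw [CZ]
  exact iInf₂_le σ h

lemma le_CZ {m : ℕ} {y : Fin (2^m) → Bool} {a : ℝ≥0∞}
    (h : ∀ σ, winning true m y σ → a ≤ pathProd true σ m y) : a ≤ CZ true m y := by
  rw [CZ]
  exact le_iInf₂ h

lemma winning_two (m : ℕ) (hm : m % 2 = 0) (y : Fin (2^(m+2)) → Bool) (σ : List Bool → Bool) :
    winning true (m+2) y σ ↔
      ∀ c, winning true m (gch m (σ []) c y) (fun q => σ (σ [] :: c :: q)) := by
  rw [winning_even (m+1) (by omega), winning_odd m (by omega)]
  rfl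

lemma pathProd_two (m : ℕ) (hm : m % 2 = 0) (y : Fin (2^(m+2)) → Bool) (σ : List Bool → Bool) :
    pathProd true σ (m+2) y = crit (m+2) y *
      ((pathProd true (fun q => σ (σ [] :: false :: q)) m (gch m (σ []) false y) +
        pathProd true (fun q => σ (σ [] :: true :: q)) m (gch m (σ []) true y)) / 2) := by
  have h1 : (m+2) % 2 = 0 := by omega
  have h2 : ¬ (m+1) % 2 = 0 := by omega
  rw [pathProd, if_pos (by simp [h1]), pathProd, if_neg (by simp; omega)]
  rfl

lemma nand_two (m : ℕ) (hm : m % 2 = 0) (y : Fin (2^(m+2)) → Bool) :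
    nand (m+2) y = (nand (m+1) (halfInput (m+1) false y) || nand (m+1) (halfInput (m+1) true y)) := by
  have h1 : (m+2) % 2 = 0 := by omega
  rw [nand, if_pos h1]

lemma nand_half (m : ℕ) (hm : m % 2 = 0) (b : Bool) (y : Fin (2^(m+2)) → Bool) :
    nand (m+1) (halfInput (m+1) b y) = (nand m (gch m b false y) && nand m (gch m b true y)) := by
  have h1 : ¬ (m+1) % 2 = 0 := by omega
  rw [nand, if_neg h1]
  rfl

/-- Series sum below child `b`. -/
noncomputable def serS (m : ℕ) (b : Bool) (y : Fin (2^(m+2)) → Bool) : ℝ≥0∞ :=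
  CZ true m (gch m b false y) + CZ true m (gch m b true y)

lemma crit_two (m : ℕ) (hm : m % 2 = 0) (y : Fin (2^(m+2)) → Bool) :
    crit (m+2) y =
      if nand (m+2) y ≠ true then 1
      else if nand (m+1) (halfInput (m+1) false y) ≠ nand (m+1) (halfInput (m+1) true y) then 2
      else max (serS m false y) (serS m true y) / ((serS m false y + serS m true y) / 2) := by
  have h1 : (m+2) % 2 = 0 := by omega
  rw [crit]
  simp only [h1, decide_true]
  rfl

lemma par_alg {a b : ℝ≥0∞} (ha : a ≠ 0) (ha' : a ≠ ⊤) (hb : b ≠ 0) (hb' : b ≠ ⊤) :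
    max a b / ((a + b) / 2) * (min a b / 2) = par a b := by
  lift a to NNReal using ha'
  lift b to NNReal using hb'
  have ha0 : a ≠ 0 := by exact_mod_cast ha
  have hb0 : b ≠ 0 := by exact_mod_cast hb
  have hab : a + b ≠ 0 := by simp [ha0]
  have h2 : (2 : ℝ≥0∞) = ((2 : NNReal) : ℝ≥0∞) := rfl
  have hi : a⁻¹ + b⁻¹ ≠ 0 := by simp [ha0]
  have key : max a b / ((a + b) / 2) * (min a b / 2) = (a⁻¹ + b⁻¹)⁻¹ := by
    have hmm : max a b * min a b = a * b := max_mul_min a b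
    have : max a b / ((a + b) / 2) * (min a b / 2) = (max a b * min a b) / (a + b) := by
      field_simp
    rw [this, hmm]
    field_simp
    rw [add_comm]
  unfold par
  rw [h2, ← ENNReal.coe_inv ha0, ← ENNReal.coe_inv hb0, ← ENNReal.coe_add, ← ENNReal.coe_add,
    ← ENNReal.coe_inv hi, ← ENNReal.coe_div (by norm_num), ← ENNReal.coe_max, ← ENNReal.coe_min,
    ← ENNReal.coe_div (by simp [ha0]), ← ENNReal.coe_div (by norm_num), ← ENNReal.coe_mul, key]

lemma par_ne_zero {a b : ℝ≥0∞} (ha : a ≠ 0) (hb : b ≠ 0) : par a b ≠ 0 := by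
  simp [par, ha, hb]

lemma par_ne_top {a b : ℝ≥0∞} : par a b ≠ ⊤ ↔ a ≠ ⊤ ∨ b ≠ ⊤ := by
  simp [par]; tauto

lemma serS_ne_zero {m : ℕ} (y : Fin (2^(m+2)) → Bool)
    (H : ∀ b c, Inv m (gch m b c y)) (b : Bool) : serS m b y ≠ 0 := by
  simp [serS, (H b false).pos]

lemma serS_ne_top {m : ℕ} (hm : m % 2 = 0) (y : Fin (2^(m+2)) → Bool)
    (H : ∀ b c, Inv m (gch m b c y)) (b : Bool) : serS m b y ≠ ⊤ ↔ nand (m+1) (halfInput (m+1) b y) = true := by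
  rw [nand_half m hm]
  have h (c : Bool) : CZ true m (gch m b c y) ≠ ⊤ ↔ nand m (gch m b c y) = true := by
    refine ⟨fun h => ?_, (H b c).win⟩
    by_contra h'
    exact h ((H b c).lose (by simpa using h'))
  simp only [serS, ne_eq, ENNReal.add_eq_top, not_or, Bool.and_eq_true]
  exact and_congr (h false) (h true)

lemma crit_mul_min {m : ℕ} (hm : m % 2 = 0) (y : Fin (2^(m+2)) → Bool)
    (H : ∀ b c, Inv m (gch m b c y)) (hn : nand (m+2) y = true) :
    crit (m+2) y * (min (serS m false y) (serS m true y) / 2)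
      = par (serS m false y) (serS m true y) := by
  have h0 := serS_ne_top hm y H false
  have h1 := serS_ne_top hm y H true
  have n2 := nand_two m hm y
  rw [crit_two m hm, if_neg (by simp [hn])]
  have h22 (a : ℝ≥0∞) : 2 * (a / 2) = a := ENNReal.mul_div_cancel (by norm_num) (by norm_num)
  cases e0 : nand (m+1) (halfInput (m+1) false y) <;>
    cases e1 : nand (m+1) (halfInput (m+1) true y)
  · simp [hn, e0, e1] at n2
  · have : serS m false y = ⊤ := by
      by_contra h; simp [h0.1 h] at e0
    simp [this, par_top_left, h22]
  · have : serS m true y = ⊤ := by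
      by_contra h; simp [h1.1 h] at e1
    simp [this, par_top_right, h22]
  · rw [if_neg (by simp)]
    exact par_alg (serS_ne_zero y H _) (h0.2 e0) (serS_ne_zero y H _) (h1.2 e1)

lemma step_win {m : ℕ} (hm : m % 2 = 0) (y : Fin (2^(m+2)) → Bool)
    (H : ∀ b c, Inv m (gch m b c y)) (hn : nand (m+2) y = true) :
    ∃ σ, winning true (m+2) y σ ∧ pathProd true σ (m+2) y = CZ true (m+2) y ∧
      CZ true (m+2) y = par (serS m false y) (serS m true y) := by
  have lower : ∀ σ, winning true (m+2) y σ →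
      par (serS m false y) (serS m true y) ≤ pathProd true σ (m+2) y := by
    intro σ hσ
    rw [winning_two m hm] at hσ
    rw [← crit_mul_min hm y H hn, pathProd_two m hm]
    gcongr
    refine le_trans ?_ (add_le_add (CZ_le (hσ false)) (CZ_le (hσ true)))
    change _ ≤ serS m (σ []) y
    cases σ []
    · exact min_le_left _ _
    · exact min_le_right _ _
  obtain ⟨b, hb⟩ : ∃ b, serS m b y = min (serS m false y) (serS m true y) := by
    rcases le_total (serS m false y) (serS m true y) with h | h
    · exact ⟨false, (min_eq_left h).symm⟩
    · exact ⟨true, (min_eq_right h).symm⟩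
  have hbt : serS m b y ≠ ⊤ := by
    have n2 := nand_two m hm y
    rw [hn] at n2
    have h0 := serS_ne_top hm y H false
    have h1 := serS_ne_top hm y H true
    rw [hb]
    rcases Bool.or_eq_true_iff.1 n2.symm with h | h
    · exact ne_top_of_le_ne_top (h0.2 h) (min_le_left _ _)
    · exact ne_top_of_le_ne_top (h1.2 h) (min_le_right _ _)
  rw [serS_ne_top hm y H, nand_half m hm, Bool.and_eq_true] at hbt
  have hc : ∀ c, nand m (gch m b c y) = true := by
    intro c; cases c
    · exact hbt.1
    · exact hbt.2
  choose ρ hρ1 hρ2 using fun c => (H b c).att (hc c)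
  let σ : List Bool → Bool := fun l => match l with
    | [] => b
    | [_] => false
    | _ :: c :: q => ρ c q
  have hw : winning true (m+2) y σ := by
    rw [winning_two m hm]
    intro c
    exact hρ1 c
  have hp : pathProd true σ (m+2) y = par (serS m false y) (serS m true y) := by
    rw [pathProd_two m hm, ← crit_mul_min hm y H hn, ← hb]
    change _ * ((pathProd true (ρ false) m (gch m b false y) +
      pathProd true (ρ true) m (gch m b true y)) / 2) = _
    rw [hρ2, hρ2]
    rfl
  have hC : CZ true (m+2) y = par (serS m false y) (serS m true y) :=
    le_antisymm (hp ▸ CZ_le hw) (le_CZ lower)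
  exact ⟨σ, hw, hp.trans hC.symm, hC⟩

lemma step_lose {m : ℕ} (hm : m % 2 = 0) (y : Fin (2^(m+2)) → Bool)
    (H : ∀ b c, Inv m (gch m b c y)) (hn : nand (m+2) y = false) : ∀ σ, ¬ winning true (m+2) y σ := by
  intro σ hσ
  rw [winning_two m hm] at hσ
  rw [nand_two m hm, Bool.or_eq_false_iff, nand_half m hm, nand_half m hm] at hn
  have : (nand m (gch m (σ []) false y) && nand m (gch m (σ []) true y)) = false := by
    cases σ []
    · exact hn.1
    · exact hn.2
  rw [Bool.and_eq_false_iff] at this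
  rcases this with h | h
  · exact (H _ _).noWin h _ (hσ false)
  · exact (H _ _).noWin h _ (hσ true)

lemma CZ_top_of {m : ℕ} {y : Fin (2^m) → Bool} (h : ∀ σ, ¬ winning true m y σ) :
    CZ true m y = ⊤ :=
  top_le_iff.1 (le_CZ fun σ hσ => absurd hσ (h σ))

lemma step_rec {m : ℕ} (hm : m % 2 = 0) (y : Fin (2^(m+2)) → Bool)
    (H : ∀ b c, Inv m (gch m b c y)) : CZ true (m+2) y = par (serS m false y) (serS m true y) := by
  cases hn : nand (m+2) y
  · rw [CZ_top_of (step_lose hm y H hn)]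
    rw [nand_two m hm, Bool.or_eq_false_iff] at hn
    have h (b : Bool) (hb : nand (m+1) (halfInput (m+1) b y) = false) : serS m b y = ⊤ := by
      by_contra h
      simp [(serS_ne_top hm y H b).1 h] at hb
    rw [h _ hn.1, h _ hn.2, par_top_left]
  · obtain ⟨σ, -, -, h⟩ := step_win hm y H hn
    exact h

lemma step_inv {m : ℕ} (hm : m % 2 = 0) (y : Fin (2^(m+2)) → Bool)
    (H : ∀ b c, Inv m (gch m b c y)) : Inv (m+2) y := by
  refine ⟨fun hn => CZ_top_of (step_lose hm y H hn), step_lose hm y H, fun hn => ?_, fun hn => ?_, ?_⟩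
  · rw [step_rec hm y H, par_ne_top, serS_ne_top hm y H, serS_ne_top hm y H]
    rwa [nand_two m hm, Bool.or_eq_true] at hn
  · obtain ⟨σ, h1, h2, -⟩ := step_win hm y H hn
    exact ⟨σ, h1, h2⟩
  · rw [step_rec hm y H]
    exact par_ne_zero (serS_ne_zero y H _) (serS_ne_zero y H _)

lemma winning_zero (y : Fin (2^0) → Bool) (σ : List Bool → Bool) :
    winning true 0 y σ ↔ nand 0 y = true := by
  simp [winning, gamePath, leafVal, leafIdx, nand]

lemma CZ_zero (y : Fin (2^0) → Bool) : CZ true 0 y = if nand 0 y = true then 1 else ⊤ := by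
  split_ifs with h
  · apply le_antisymm
    · refine (CZ_le ((winning_zero y (fun _ => false)).2 h)).trans ?_
      rw [pathProd]
    · refine le_CZ fun σ _ => ?_
      rw [pathProd]
  · exact CZ_top_of fun σ hσ => h ((winning_zero y σ).1 hσ)

lemma inv_zero (y : Fin (2^0) → Bool) : Inv 0 y := by
  refine ⟨fun h => ?_, fun h σ hσ => ?_, fun h => ?_, fun h => ?_, ?_⟩
  · simp [CZ_zero, h]
  · simp [winning_zero, h] at hσ
  · simp [CZ_zero, h]
  · refine ⟨fun _ => false, (winning_zero _ _).2 h, ?_⟩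
    rw [CZ_zero, pathProd, if_pos h]
  · rw [CZ_zero]; split_ifs <;> simp

lemma inv_all (d : ℕ) (y : Fin (2^(2*d)) → Bool) : Inv (2*d) y := by
  induction d with
  | zero => exact inv_zero y
  | succ d ih => exact step_inv (m := 2*d) (by omega) y (fun b c => ih _)

/-! ### Network side -/

/-- Typed edge constructor. -/
def mkE {d : ℕ} (e : Edg d) (b c : Bool) : Edg (d+1) := (e, b, c)

/-- Typed embedding of old vertices. -/
def inV {d : ℕ} (v : Vtx d) : Vtx (d+1) := Sum.inl v

/-- Typed middle vertices. -/
def midV {d : ℕ} (e : Edg d) (b : Bool) : Vtx (d+1) := Sum.inr (e, b)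

/-- Classical indicator of equality. -/
noncomputable def ind {V : Type} (a b : V) : ℝ := if a = b then 1 else 0

lemma ind_self {V : Type} (a : V) : ind a a = 1 := by simp [ind]

lemma ind_ne {V : Type} {a b : V} (h : a ≠ b) : ind a b = 0 := by simp [ind, h]

lemma ind_inV {d : ℕ} (v w : Vtx d) : ind (inV v) (inV w) = ind v w := by
  by_cases h : v = w
  · subst h; rw [ind_self, ind_self]
  · rw [ind_ne h, ind_ne]
    intro h'; exact h (Sum.inl.inj h')

lemma ind_in_mid {d : ℕ} (v : Vtx d) (e : Edg d) (b : Bool) : ind (inV v) (midV e b) = 0 :=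
  ind_ne fun h => by cases h

lemma ind_mid_in {d : ℕ} (v : Vtx d) (e : Edg d) (b : Bool) : ind (midV e b) (inV v) = 0 :=
  ind_ne fun h => by cases h

lemma ind_mid_ne {d : ℕ} {e e' : Edg d} (b b' : Bool) (h : e' ≠ e) :
    ind (midV e' b') (midV e b) = 0 :=
  ind_ne fun h' => h (Prod.mk.inj (Sum.inr.inj h')).1

lemma ind_mid_mid {d : ℕ} (e : Edg d) (b b' : Bool) :
    ind (midV e b') (midV e b) = if b' = b then 1 else 0 := by
  by_cases h : b' = b
  · subst h; rw [ind_self]; simp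
  · rw [if_neg h]
    exact ind_ne fun h' => h (Prod.mk.inj (Sum.inr.inj h')).2

lemma netFlow_ind {V E : Type} [Fintype E] (epf : E → Bool → V) (θ : E → ℝ) (v : V) :
    netFlow epf θ v = ∑ e, θ e * (ind (epf e false) v - ind (epf e true) v) := rfl

lemma ep_ff {d : ℕ} (e : Edg d) (b : Bool) :
    ep (d+1) (mkE e b false) false = inV (ep d e false) := rfl
lemma ep_ft {d : ℕ} (e : Edg d) (b : Bool) : ep (d+1) (mkE e b false) true = midV e b := rfl
lemma ep_tf {d : ℕ} (e : Edg d) (b : Bool) : ep (d+1) (mkE e b true) false = midV e b := rfl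
lemma ep_tt {d : ℕ} (e : Edg d) (b : Bool) :
    ep (d+1) (mkE e b true) true = inV (ep d e true) := rfl
lemma sVtx_succ (d : ℕ) : sVtx (d+1) = inV (sVtx d) := rfl
lemma tVtx_succ (d : ℕ) : tVtx (d+1) = inV (tVtx d) := rfl

/-- Merge the four resistances replacing each edge into one. -/
noncomputable def mergeR {d : ℕ} (r : Edg (d+1) → ℝ≥0∞) : Edg d → ℝ≥0∞ := fun e =>
  par (r  (mkE e false false) + r  (mkE e false true)) (r  (mkE e true false) + r  (mkE e true true))

/-- The series-parallel resistance, reduced from the finest level upwards. -/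
noncomputable def Rn : (d : ℕ) → (Edg d → ℝ≥0∞) → ℝ≥0∞
  | 0, r => r ()
  | (d+1), r => Rn d (mergeR r)

/-- Embed `G_d` in `G_{d+1}` as the copy replacing the edge labelled `bc` of `G_1`. -/
def topE : (d : ℕ) → Bool → Bool → Edg d → Edg (d+1)
  | 0, b, c, _ => ((), b, c)
  | (d+1), b, c, (e, b', c') => (topE d b c e, b', c')

lemma Rn_top (d : ℕ) (r : Edg (d+1) → ℝ≥0∞) :
    Rn (d+1) r = par
      (Rn d (fun e => r (topE d false false e)) + Rn d (fun e => r (topE d false true e)))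
      (Rn d (fun e => r (topE d true false e)) + Rn d (fun e => r (topE d true true e))) := by
  induction d with
  | zero => rfl
  | succ d ih =>
    rw [Rn, ih]
    rfl

lemma elabel_top (d : ℕ) (b c : Bool) (e : Edg d) :
    elabel (d+1) (topE d b c e) = b :: c :: elabel d e := by
  induction d with
  | zero => rfl
  | succ d ih =>
    obtain ⟨e, b', c'⟩ := e
    change elabel (d+1) (topE d b c e) ++ [b', c'] = b :: c :: (elabel d e ++ [b', c'])
    rw [ih]; rfl

lemma elabel_length (d : ℕ) (e : Edg d) : (elabel d e).length = 2 * d := by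
  induction d with
  | zero => rfl
  | succ d ih =>
    obtain ⟨e, b', c'⟩ := e
    change (elabel d e ++ [b', c']).length = _
    simp [ih]; omega

lemma edgeBit_top (d : ℕ) (x : Fin (2^(2*(d+1))) → Bool) (b c : Bool) (e : Edg d) :
    edgeBit (d+1) x (topE d b c e) = edgeBit d (gch (2*d) b c x) e := by
  unfold edgeBit
  rw [elabel_top]
  have h := elabel_length d e
  have h1 := leafVal_cons (2*d+1) x b (c :: elabel d e) (by simp [h])
  rw [leafVal_cons (2*d) _ c _ h] at h1
  exact h1

/-- Resistances of the kept edges. -/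
noncomputable def resOf (d : ℕ) (x : Fin (2^(2*d)) → Bool) (e : Edg d) : ℝ≥0∞ :=
  if edgeBit d x e = true then 1 else ⊤

lemma CZ_eq_Rn (d : ℕ) (x : Fin (2^(2*d)) → Bool) : CZ true (2*d) x = Rn d (resOf d x) := by
  induction d with
  | zero =>
    refine (CZ_zero x).trans ?_
    simp only [Rn, resOf]
    congr 1
  | succ d ih =>
    have h := step_rec (m := 2*d) (by omega) x (fun b c => inv_all d _)
    refine Eq.trans h ?_
    rw [Rn_top]
    simp only [serS, ih]
    have (b c : Bool) : (fun e => resOf (d+1) x (topE d b c e)) = resOf d (gch (2*d) b c x) := by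
      funext e
      simp only [resOf, edgeBit_top]
    simp only [this]

/-- A unit flow in `G_d`, without support condition. -/
def UF (d : ℕ) (θ : Edg d → ℝ) : Prop :=
  ∀ v, netFlow (ep d) θ v = ind v (sVtx d) - ind v (tVtx d)

lemma isUnitFlow_iff {V E : Type} [Fintype E] (epf : E → Bool → V) (keep : E → Prop)
    (s t : V) (θ : E → ℝ) : IsUnitFlow epf keep s t θ ↔
      (∀ e, ¬ keep e → θ e = 0) ∧ ∀ v, netFlow epf θ v = ind v s - ind v t := Iff.rfl

lemma sum_aux {M E : Type} [AddCommMonoid M] [Fintype E] (f : E × Bool × Bool → M) :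
    ∑ e, f e = ∑ e : E, (f (e, false, false) + f (e, false, true) +
      (f (e, true, false) + f (e, true, true))) := by
  rw [Fintype.sum_prod_type]
  refine Finset.sum_congr rfl fun e _ => ?_
  rw [Fintype.sum_prod_type]
  simp only [Fintype.sum_bool]
  abel

lemma sum_edg {M : Type} [AddCommMonoid M] (d : ℕ) (f : Edg (d+1) → M) :
    ∑ e, f e = ∑ e : Edg d, (f (mkE e false false) + f (mkE e false true) +
      (f (mkE e true false) + f (mkE e true true))) :=
  sum_aux (E := Edg d) f

lemma sum_edg_zero {M : Type} [AddCommMonoid M] (f : Edg 0 → M) : ∑ e, f e = f () :=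
  Fintype.sum_unique (ι := Unit) f

lemma netFlow_mid (d : ℕ) (θ : Edg (d+1) → ℝ) (e : Edg d) (b : Bool) :
    netFlow (ep (d+1)) θ (midV e b) = θ (mkE e b true) - θ (mkE e b false) := by
  rw [netFlow_ind, sum_edg]
  simp only [ep_ff, ep_ft, ep_tf, ep_tt, ind_in_mid]
  rw [Finset.sum_eq_single e]
  · simp only [ind_mid_mid]
    cases b <;> simp <;> ring
  · intro e' _ hne
    simp [ind_mid_ne _ _ hne]
  · simp

lemma netFlow_inl (d : ℕ) (θ : Edg (d+1) → ℝ) (v : Vtx d)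
    (h : ∀ e b, θ (mkE e b true) = θ (mkE e b false)) :
    netFlow (ep (d+1)) θ (inV v)
      = netFlow (ep d) (fun e => θ (mkE e false false) + θ (mkE e true false)) v := by
  rw [netFlow_ind, netFlow_ind, sum_edg]
  simp only [ep_ff, ep_ft, ep_tf, ep_tt, ind_mid_in, ind_inV, h]
  refine Finset.sum_congr rfl fun e _ => ?_
  ring

lemma UF_succ (d : ℕ) (θ : Edg (d+1) → ℝ) :
    UF (d+1) θ ↔ (∀ e b, θ (mkE e b true) = θ (mkE e b false)) ∧
      UF d (fun e => θ (mkE e false false) + θ (mkE e true false)) := by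
  constructor
  · intro h
    have hmid : ∀ e b, θ (mkE e b true) = θ (mkE e b false) := by
      intro e b
      have := h (midV e b)
      rw [netFlow_mid, sVtx_succ, tVtx_succ, ind_mid_in, ind_mid_in] at this
      linarith
    refine ⟨hmid, fun v => ?_⟩
    have := h (inV v)
    rwa [netFlow_inl d θ v hmid, sVtx_succ, tVtx_succ, ind_inV, ind_inV] at this
  · rintro ⟨hmid, h⟩ (v | ⟨e, b⟩)
    · change netFlow (ep (d+1)) θ (inV v) = ind (inV v) _ - ind (inV v) _
      rw [netFlow_inl d θ v hmid, h v, sVtx_succ, tVtx_succ, ind_inV, ind_inV]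
    · change netFlow (ep (d+1)) θ (midV e b) = ind (midV e b) _ - ind (midV e b) _
      rw [netFlow_mid, hmid, sVtx_succ, tVtx_succ, ind_mid_in, ind_mid_in]
      ring

lemma UF_zero (θ : Edg 0 → ℝ) : UF 0 θ ↔ θ () = 1 := by
  have h1 : ind (V := Vtx 0) (ep 0 () false) (sVtx 0) = 1 := ind_self _
  have h2 : ind (V := Vtx 0) (ep 0 () true) (sVtx 0) = 0 := ind_ne (V := Bool) (Ne.symm Bool.false_ne_true)
  have h3 : ind (V := Vtx 0) (ep 0 () false) (tVtx 0) = 0 := ind_ne (V := Bool) Bool.false_ne_true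
  have h4 : ind (V := Vtx 0) (ep 0 () true) (tVtx 0) = 1 := ind_self _
  have h5 : ind (sVtx 0) (tVtx 0) = 0 := h3
  have h6 : ind (tVtx 0) (sVtx 0) = 0 := h2
  constructor
  · intro h
    have := h (sVtx 0)
    rw [netFlow_ind, sum_edg_zero, h1, h2, ind_self, h5] at this
    linarith
  · intro h v
    have hv : v = sVtx 0 ∨ v = tVtx 0 := by
      change Bool at v
      cases v
      · exact Or.inl rfl
      · exact Or.inr rfl
    rw [netFlow_ind, sum_edg_zero, h]
    rcases hv with rfl | rfl
    · rw [h1, h2, ind_self, h5]; ring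
    · rw [h3, h4, ind_self, h6]; ring

/-- Energy with edge resistances. -/
noncomputable def energy (d : ℕ) (r : Edg d → ℝ≥0∞) (θ : Edg d → ℝ) : ℝ≥0∞ :=
  ∑ e, r e * ENNReal.ofReal ((θ e)^2)

lemma par_coe {a b : NNReal} (ha : a ≠ 0) (hb : b ≠ 0) :
    par (a : ℝ≥0∞) b = ((a * b / (a + b) : NNReal) : ℝ≥0∞) := by
  have hi : a⁻¹ + b⁻¹ ≠ 0 := by simp [ha]
  have hab : a + b ≠ 0 := by simp [ha]
  unfold par
  rw [← ENNReal.coe_inv ha, ← ENNReal.coe_inv hb, ← ENNReal.coe_add, ← ENNReal.coe_inv hi]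
  congr 1
  field_simp
  rw [add_comm]

lemma coe_mul_ofReal (a : NNReal) (t : ℝ) :
    (a : ℝ≥0∞) * ENNReal.ofReal t = ENNReal.ofReal (a * t) := by
  rw [ENNReal.ofReal_mul a.coe_nonneg, ENNReal.ofReal_coe_nnreal]

lemma par_lower {a b : ℝ≥0∞} (ha : a ≠ 0) (hb : b ≠ 0) (p q : ℝ) :
    par a b * ENNReal.ofReal ((p + q)^2)
      ≤ a * ENNReal.ofReal (p^2) + b * ENNReal.ofReal (q^2) := by
  rcases eq_or_ne a ⊤ with rfl | ha'
  · rw [par_top_left]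
    rcases eq_or_ne p 0 with rfl | hp
    · simp
    · rw [ENNReal.top_mul]
      · simp
      · rw [ne_eq, ENNReal.ofReal_eq_zero, not_le]; positivity
  rcases eq_or_ne b ⊤ with rfl | hb'
  · rw [par_top_right]
    rcases eq_or_ne q 0 with rfl | hq
    · simp
    · rw [ENNReal.top_mul]
      · simp
      · rw [ne_eq, ENNReal.ofReal_eq_zero, not_le]; positivity
  lift a to NNReal using ha'
  lift b to NNReal using hb'
  have ha0 : a ≠ 0 := by exact_mod_cast ha
  have hb0 : b ≠ 0 := by exact_mod_cast hb
  have ha1 : (0:ℝ) < a := by positivity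
  have hb1 : (0:ℝ) < b := by positivity
  rw [par_coe ha0 hb0, coe_mul_ofReal, coe_mul_ofReal, coe_mul_ofReal,
    ← ENNReal.ofReal_add (by positivity) (by positivity)]
  apply ENNReal.ofReal_le_ofReal
  push_cast
  rw [div_mul_eq_mul_div, div_le_iff₀ (by positivity)]
  nlinarith [sq_nonneg ((a:ℝ) * p - b * q)]

lemma par_attain {a b : ℝ≥0∞} (ha : a ≠ 0) (hb : b ≠ 0) (t : ℝ) :
    ∃ p q : ℝ, p + q = t ∧ a * ENNReal.ofReal (p^2) + b * ENNReal.ofReal (q^2)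
      ≤ par a b * ENNReal.ofReal (t^2) := by
  rcases eq_or_ne a ⊤ with rfl | ha'
  · exact ⟨0, t, by simp, by simp [par_top_left]⟩
  rcases eq_or_ne b ⊤ with rfl | hb'
  · exact ⟨t, 0, by simp, by simp [par_top_right]⟩
  lift a to NNReal using ha'
  lift b to NNReal using hb'
  have ha0 : a ≠ 0 := by exact_mod_cast ha
  have hb0 : b ≠ 0 := by exact_mod_cast hb
  have ha1 : (0:ℝ) < a := by positivity
  have hb1 : (0:ℝ) < b := by positivity
  refine ⟨t * b / (a + b), t * a / (a + b), by field_simp; ring, ?_⟩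
  rw [par_coe ha0 hb0, coe_mul_ofReal, coe_mul_ofReal, coe_mul_ofReal,
    ← ENNReal.ofReal_add (by positivity) (by positivity)]
  apply ENNReal.ofReal_le_ofReal
  push_cast
  apply le_of_eq
  field_simp
  ring

lemma energy_succ (d : ℕ) (r : Edg (d+1) → ℝ≥0∞) (θ : Edg (d+1) → ℝ)
    (h : ∀ e b, θ  (mkE e b true) = θ  (mkE e b false)) :
    energy (d+1) r θ = ∑ e : Edg d,
      ((r  (mkE e false false) + r  (mkE e false true)) * ENNReal.ofReal (θ  (mkE e false false)^2) +
       (r  (mkE e true false) + r  (mkE e true true)) * ENNReal.ofReal (θ  (mkE e true false)^2)) := by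
  unfold energy
  rw [sum_edg]
  simp only [h, add_mul]

lemma add_ne_zero_of {α : Type} {r : α → ℝ≥0∞} (hr : ∀ e, r e ≠ 0) (a b : α) :
    r a + r b ≠ 0 := by simp [hr]

lemma mergeR_ne_zero {d : ℕ} {r : Edg (d+1) → ℝ≥0∞} (hr : ∀ e, r e ≠ 0) (e : Edg d) :
    mergeR r e ≠ 0 := par_ne_zero (add_ne_zero_of hr _ _) (add_ne_zero_of hr _ _)

lemma Rn_le (d : ℕ) (r : Edg d → ℝ≥0∞) (hr : ∀ e, r e ≠ 0) (θ : Edg d → ℝ) (hθ : UF d θ) :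
    Rn d r ≤ energy d r θ := by
  induction d with
  | zero =>
    rw [energy, sum_edg_zero, (UF_zero θ).1 hθ]
    simp [Rn]
  | succ d ih =>
    obtain ⟨hmid, h⟩ := (UF_succ d θ).1 hθ
    refine (ih (mergeR r) (mergeR_ne_zero hr) _ h).trans ?_
    rw [energy_succ d r θ hmid]
    exact Finset.sum_le_sum fun e _ => par_lower (add_ne_zero_of hr _ _) (add_ne_zero_of hr _ _) _ _

lemma Rn_attain (d : ℕ) (r : Edg d → ℝ≥0∞) (hr : ∀ e, r e ≠ 0) :
    ∃ θ, UF d θ ∧ energy d r θ ≤ Rn d r := by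
  induction d with
  | zero =>
    refine ⟨fun _ => 1, (UF_zero _).2 rfl, ?_⟩
    rw [energy, sum_edg_zero]
    simp [Rn]
  | succ d ih =>
    obtain ⟨θ, h1, h2⟩ := ih (mergeR r) (mergeR_ne_zero hr)
    choose p q hpq hle using fun e => par_attain
      (a := r  (mkE e false false) + r  (mkE e false true))
      (b := r  (mkE e true false) + r  (mkE e true true)) (add_ne_zero_of hr _ _) (add_ne_zero_of hr _ _) (θ e)
    let θ' : Edg (d+1) → ℝ := fun z => cond z.2.1 (q z.1) (p z.1)
    have hmid : ∀ e b, θ'  (mkE e b true) = θ'  (mkE e b false) := fun e b => rfl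
    refine ⟨θ', (UF_succ d θ').2 ⟨hmid, ?_⟩, ?_⟩
    · have : (fun e => θ'  (mkE e false false) + θ'  (mkE e true false)) = θ := funext hpq
      rw [this]; exact h1
    · rw [energy_succ d r θ' hmid]
      exact (Finset.sum_le_sum fun e _ => hle e).trans h2

lemma adjE_symm {V E : Type} {epf : E → Bool → V} {keep : E → Prop} {u v : V}
    (h : adjE epf keep u v) : adjE epf keep v u := by
  obtain ⟨e, he, h⟩ := h
  exact ⟨e, he, h.symm⟩

lemma connected_of_Rn (d : ℕ) (r : Edg d → ℝ≥0∞) (h : Rn d r ≠ ⊤) :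
    ConnectedIn (ep d) (fun e => r e ≠ ⊤) (sVtx d) (tVtx d) := by
  induction d with
  | zero => exact Relation.ReflTransGen.single ⟨(), h, Or.inl ⟨rfl, rfl⟩⟩
  | succ d ih =>
    refine Relation.ReflTransGen.lift' (fun v => inV v) ?_ _ _ (ih (mergeR r) h)
    rintro u v ⟨e, he, huv⟩
    obtain ⟨b, hb0, hb1⟩ : ∃ b, r  (mkE e b false) ≠ ⊤ ∧ r  (mkE e b true) ≠ ⊤ := by
      rcases par_ne_top.1 he with h | h
      · exact ⟨false, by simpa using h⟩
      · exact ⟨true, by simpa using h⟩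
    have A : adjE (ep (d+1)) (fun e => r e ≠ ⊤) (inV (ep d e false)) (midV e b) :=
      ⟨ (mkE e b false), hb0, Or.inl ⟨rfl, rfl⟩⟩
    have B : adjE (ep (d+1)) (fun e => r e ≠ ⊤) (midV e b) (inV (ep d e true)) :=
      ⟨ (mkE e b true), hb1, Or.inl ⟨rfl, rfl⟩⟩
    rcases huv with ⟨rfl, rfl⟩ | ⟨rfl, rfl⟩
    · exact (Relation.ReflTransGen.single A).tail B
    · exact (Relation.ReflTransGen.single (adjE_symm B)).tail (adjE_symm A)

lemma energy_resOf (d : ℕ) (x : Fin (2^(2*d)) → Bool) (θ : Edg d → ℝ)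
    (h : ∀ e, ¬ edgeBit d x e = true → θ e = 0) :
    energy d (resOf d x) θ = ENNReal.ofReal (∑ e, (θ e)^2) := by
  rw [ENNReal.ofReal_sum_of_nonneg (fun e _ => sq_nonneg _)]
  refine Finset.sum_congr rfl fun e _ => ?_
  by_cases he : edgeBit d x e = true
  · simp [resOf, he]
  · simp [h e he]

lemma Rn_eq_effRes (d : ℕ) (x : Fin (2^(2*d)) → Bool) :
    Rn d (resOf d x)
      = effRes (ep d) (fun e => edgeBit d x e = true) (sVtx d) (tVtx d) := by
  have hr : ∀ e, resOf d x e ≠ 0 := by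
    intro e; unfold resOf; split_ifs <;> simp
  have hk : (fun e => resOf d x e ≠ ⊤) = (fun e => edgeBit d x e = true) := by
    funext e; simp [resOf]
  unfold effRes
  split_ifs with hc
  · apply le_antisymm
    · refine le_iInf₂ fun θ hθ => ?_
      have hθ := (isUnitFlow_iff _ _ _ _ _).1 hθ
      rw [← energy_resOf d x θ hθ.1]
      exact Rn_le d _ hr θ hθ.2
    · rcases eq_or_ne (Rn d (resOf d x)) ⊤ with ht | ht
      · rw [ht]; exact le_top
      obtain ⟨θ, h1, h2⟩ := Rn_attain d (resOf d x) hr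
      have hs : ∀ e, ¬ edgeBit d x e = true → θ e = 0 := by
        intro e he
        by_contra hne
        have hfin : energy d (resOf d x) θ ≠ ⊤ := ne_top_of_le_ne_top ht h2
        have := ENNReal.sum_ne_top.1 hfin e (Finset.mem_univ e)
        apply this
        rw [resOf, if_neg he, ENNReal.top_mul]
        rw [ne_eq, ENNReal.ofReal_eq_zero, not_le]; positivity
      refine le_trans ?_ h2
      rw [energy_resOf d x θ hs]
      exact iInf₂_le θ ((isUnitFlow_iff _ _ _ _ _).2 ⟨hs, h1⟩)
  · by_contra hne
    apply hc
    have := connected_of_Rn d _ hne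
    rwa [hk] at this

/-- `C_A(x) = R_{s,t}(G_d(x))`; in particular both sides are `∞`
exactly when `x` is a `0`-instance. -/
theorem CA_eq_effRes (d : ℕ) (x : Fin (2^(2*d)) → Bool) :
    CZ true (2*d) x
      = effRes (ep d) (fun e => edgeBit d x e = true) (sVtx d) (tVtx d) ∧
    (CZ true (2*d) x = ⊤ ↔ nand (2*d) x = false) := by
  refine ⟨(CZ_eq_Rn d x).trans (Rn_eq_effRes d x), fun h => ?_, (inv_all d x).lose⟩
  by_contra hn
  exact (inv_all d x).win (by simpa using hn) h

end NandTree
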